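/- Let α be a simple closed curve in ℝ² and let f be a continuous map, defined and without fixed points on the union of Im α and the bounded component int α of ℝ² ∖ Im α, with values in ℝ². Then i(f, α) = 0. -/

import Mathlib

open Set

/-- `θ` is a continuous argument lift on `[a, b]` of the (nonvanishing) vector field `v`:
`v t = ‖v t‖ · exp(2πi·θ t)` for all `t ∈ [a, b]`. -/
def IsArgLift (v : ℝ → ℂ) (a b : ℝ) (θ : ℝ → ℝ) : Prop :=
  ContinuousOn θ (Set.Icc a b) ∧
    ∀ t ∈ Set.Icc a b,
      v t = (‖v t‖ : ℂ) * Complex.exp (2 * Real.pi * Complex.I * θ t)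

/-- The index of the map `f` along the path `α : [a, b] → ℂ` equals `c`:
every continuous argument lift `θ` of `t ↦ f (α t) - α t` satisfies `θ b - θ a = c`. -/
def HasIndex (f : ℂ → ℂ) (α : ℝ → ℂ) (a b : ℝ) (c : ℝ) : Prop :=
  ∀ θ : ℝ → ℝ, IsArgLift (fun t => f (α t) - α t) a b θ → θ b - θ a = c

/-- A simple closed curve parametrized on `[a, b]`. -/
def IsSimpleClosedCurve (α : ℝ → ℂ) (a b : ℝ) : Prop :=
  a < b ∧ ContinuousOn α (Set.Icc a b) ∧ α a = α b ∧ Set.InjOn α (Set.Ico a b)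

/-- An arc (injective continuous path) parametrized on `[a, b]`. -/
def IsArcOn (α : ℝ → ℂ) (a b : ℝ) : Prop :=
  a < b ∧ ContinuousOn α (Set.Icc a b) ∧ Set.InjOn α (Set.Icc a b)

/-- `I` is the interior (the bounded complementary component) of the Jordan curve `C`. -/
def IsInteriorOf (C I : Set ℂ) : Prop :=
  Bornology.IsBounded I ∧ ∃ x ∈ Cᶜ, I = connectedComponentIn Cᶜ x

/-- `E` is the exterior (the unbounded complementary component) of the Jordan curve `C`. -/
def IsExteriorOf (C E : Set ℂ) : Prop :=
  ¬ Bornology.IsBounded E ∧ ∃ x ∈ Cᶜ, E = connectedComponentIn Cᶜ x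

/-- A simple closed curve is positively oriented (its interior lies on its left) iff it has
winding number `+1` around every point of its interior. -/
def IsPositivelyOriented (α : ℝ → ℂ) (a b : ℝ) : Prop :=
  ∀ I : Set ℂ, IsInteriorOf (α '' Set.Icc a b) I → ∀ z ∈ I,
    ∀ θ : ℝ → ℝ, IsArgLift (fun t => α t - z) a b θ → θ b - θ a = 1

/-- A homeomorphism of the plane is orientation preserving iff it is isotopic to the
identity through homeomorphisms. -/
def OrientationPreserving (h : ℂ ≃ₜ ℂ) : Prop :=
  ∃ H : ℝ → ℂ → ℂ, Continuous (fun p : ℝ × ℂ => H p.1 p.2) ∧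
    (∀ t ∈ Set.Icc (0 : ℝ) 1, IsHomeomorph (H t)) ∧ H 0 = id ∧ H 1 = ⇑h

/-- `F` is compactly connected: any two points of `F` lie in a common subcontinuum of `F`. -/
def CompactlyConnected (F : Set ℂ) : Prop :=
  ∀ x ∈ F, ∀ y ∈ F, ∃ K : Set ℂ, K ⊆ F ∧ x ∈ K ∧ y ∈ K ∧ IsCompact K ∧ IsConnected K

/-- The open subarc of the closed curve `α : [a,b] → ℂ` (with `α a = α b`) traversed in the
positive direction from parameter `u` to parameter `v`. -/
def cyclicOpenArc (α : ℝ → ℂ) (a b u v : ℝ) : Set ℂ :=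
  if u ≤ v then α '' Set.Ioo u v else α '' Set.Ioc u b ∪ α '' Set.Ioo a v

/-- A nowhere vanishing continuous function on a simply connected, locally path connected space
has a continuous logarithm. -/
theorem exists_continuous_log {X : Type*} [TopologicalSpace X] [SimplyConnectedSpace X]
    [LocallyPathConnectedSpace X] {u : X → ℂ} (hu : Continuous u) (h0 : ∀ x, u x ≠ 0) :
    ∃ L : X → ℂ, Continuous L ∧ ∀ x, Complex.exp (L x) = u x := by
  obtain ⟨x₀⟩ : Nonempty X := inferInstance
  obtain ⟨F, ⟨-, hF⟩, -⟩ := Complex.isCoveringMapOn_exp.existsUnique_continuousMap_lifts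
    (A := X) ⟨u, hu⟩ (a₀ := x₀) (e₀ := Complex.log (u x₀)) (Complex.exp_log (h0 x₀)) h0
  exact ⟨F, F.continuous, fun x => congrFun hF x⟩

/-- If `z ↦ (z - p) ^ n` on a circle around `p` extends to a nowhere vanishing continuous
function on the plane, then `n = 0`. -/
theorem eq_zero_of_extension_zpow {G : ℂ → ℂ} (hG : Continuous G) (h0 : ∀ z, G z ≠ 0)
    {p : ℂ} {R : ℝ} (hR : 0 < R) {n : ℤ} (hn : ∀ z, ‖z - p‖ = R → G z = (z - p) ^ n) :
    n = 0 := by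
  obtain ⟨L, hL, hLG⟩ := exists_continuous_log hG h0
  let c : ℝ → ℂ := fun t => p + R * Complex.exp (t * Complex.I)
  let k : ℝ → ℂ := fun t => L (c t) - n * (t * Complex.I)
  have hk : Continuous k := by fun_prop
  have hexp : ∀ t, Complex.exp (k t) = (R : ℂ) ^ n := by
    intro t
    have h1 : c t - p = R * Complex.exp (t * Complex.I) := by simp [c]
    have h2 : ‖c t - p‖ = R := by
      rw [h1, norm_mul, Complex.norm_exp_ofReal_mul_I]
      simp [abs_of_pos hR]
    simp only [k]
    rw [Complex.exp_sub, hLG, hn _ h2, h1, mul_zpow, Complex.exp_int_mul]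
    field_simp
  have hconst : k (2 * Real.pi) = k 0 := by
    obtain ⟨F, -, hF⟩ := Complex.isCoveringMapOn_exp.existsUnique_continuousMap_lifts
      (A := ℝ) (ContinuousMap.const ℝ ((R : ℂ) ^ n)) (a₀ := 0) (e₀ := k 0) (hexp 0)
      (fun _ => zpow_ne_zero _ (by exact_mod_cast hR.ne'))
    have e1 := hF ⟨k, hk⟩ ⟨rfl, funext hexp⟩
    have e2 := hF (ContinuousMap.const ℝ (k 0)) ⟨rfl, funext fun _ => hexp 0⟩
    exact congrFun (congrArg DFunLike.coe (e1.trans e2.symm)) (2 * Real.pi)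
  have hc : c (2 * Real.pi) = c 0 := by
    simp [c, Complex.exp_two_pi_mul_I]
  simp only [k, hc] at hconst
  simpa [Real.pi_ne_zero] using hconst

/-- A continuous function of the parameter of a simple closed curve which agrees at the two
endpoints is induced by a continuous function on the plane. -/
theorem IsSimpleClosedCurve.exists_continuous_comp_eq {α : ℝ → ℂ} {a b : ℝ}
    (hα : IsSimpleClosedCurve α a b) {h : ℝ → ℂ} (hh : ContinuousOn h (Set.Icc a b))
    (hab : h a = h b) :
    ∃ H : ℂ → ℂ, Continuous H ∧ ∀ t ∈ Set.Icc a b, H (α t) = h t := by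
  obtain ⟨hlt, hc, hend, hinj⟩ := hα
  let q : Set.Icc a b → α '' Set.Icc a b := fun t => ⟨α t, mem_image_of_mem α t.2⟩
  have hqc : Continuous q := hc.domRestrict.subtype_mk _
  have hq : Topology.IsQuotientMap q :=
    hqc.isClosedMap.isQuotientMap hqc fun ⟨_, t, ht, e⟩ => ⟨⟨t, ht⟩, Subtype.ext e⟩
  have hne : ∀ s ∈ Set.Icc a b, ∀ t ∈ Set.Icc a b, α s = α t → h s = h t := by
    have key : ∀ s ∈ Set.Icc a b, ∃ s' ∈ Set.Ico a b, α s = α s' ∧ h s = h s' := by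
      intro s hs
      rcases hs.2.eq_or_lt with rfl | hsb
      · exact ⟨a, ⟨le_rfl, hlt⟩, hend.symm, hab.symm⟩
      · exact ⟨s, ⟨hs.1, hsb⟩, rfl, rfl⟩
    intro s hs t ht hst
    obtain ⟨s', hs', e1, e2⟩ := key s hs
    obtain ⟨t', ht', e3, e4⟩ := key t ht
    rw [e2, e4, hinj hs' ht' (by rw [← e1, ← e3, hst])]
  have hfac : Function.FactorsThrough (⟨_, hh.domRestrict⟩ : C(Set.Icc a b, ℂ)) q :=
    fun s t hst => hne s s.2 t t.2 (congrArg Subtype.val hst)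
  have hcl : IsClosed (α '' Set.Icc a b) := (isCompact_Icc.image_of_continuousOn hc).isClosed
  obtain ⟨H, hH⟩ := ContinuousMap.exists_restrict_eq hcl
    (hq.lift (f := ⟨q, hqc⟩) ⟨_, hh.domRestrict⟩ hfac)
  refine ⟨H, H.continuous, fun t ht => ?_⟩
  have e1 := DFunLike.congr_fun hH (q ⟨t, ht⟩)
  have e2 := DFunLike.congr_fun
    (hq.lift_comp (f := ⟨q, hqc⟩) ⟨_, hh.domRestrict⟩ hfac) ⟨t, ht⟩
  exact e1.trans e2

/-- The closure of a connected component of the complement of a set adds only points of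
that set. -/
theorem closure_connectedComponentIn_compl_subset {X : Type*} [TopologicalSpace X]
    {C : Set X} (x : X) :
    closure (connectedComponentIn Cᶜ x) ⊆ C ∪ connectedComponentIn Cᶜ x := by
  intro y hy
  by_cases hyC : y ∈ C
  · exact Or.inl hyC
  refine Or.inr ?_
  obtain ⟨w, hw⟩ := closure_nonempty_iff.1 ⟨y, hy⟩
  have hx : x ∈ Cᶜ := connectedComponentIn_nonempty_iff.1 ⟨w, hw⟩
  have hpre : IsPreconnected (insert y (connectedComponentIn Cᶜ x)) :=
    isPreconnected_connectedComponentIn.subset_closure (subset_insert _ _)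
      (insert_subset hy subset_closure)
  exact hpre.subset_connectedComponentIn (mem_insert_of_mem _ (mem_connectedComponentIn hx))
    (insert_subset hyC (connectedComponentIn_subset _ _)) (mem_insert _ _)

/-- If `f` is continuous and fixed point free on a simple closed curve together with its
interior, then the index of `f` along the curve is `0`. -/
theorem index_zero_of_fixed_point_free_extension
    (α : ℝ → ℂ) (a b : ℝ) (hα : IsSimpleClosedCurve α a b)
    (I : Set ℂ) (hI : IsInteriorOf (α '' Set.Icc a b) I)
    (f : ℂ → ℂ) (hf : ContinuousOn f (α '' Set.Icc a b ∪ I))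
    (hfix : ∀ z ∈ α '' Set.Icc a b ∪ I, f z ≠ z) :
    HasIndex f α a b 0 := by
  classical
  intro θ ⟨hθc, hθ⟩
  have hα' := hα
  obtain ⟨hlt, hc, hend, -⟩ := hα'
  obtain ⟨hIb, p, hpC, hIp⟩ := hI
  set C : Set ℂ := α '' Set.Icc a b with hC
  have hCcomp : IsCompact C := isCompact_Icc.image_of_continuousOn hc
  have hIo : IsOpen I := hIp ▸ hCcomp.isClosed.isOpen_compl.connectedComponentIn
  have hpI : p ∈ I := hIp ▸ mem_connectedComponentIn hpC
  have hKcl : IsClosed (C ∪ I) := by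
    refine isClosed_of_closure_subset ?_
    rw [closure_union, hCcomp.isClosed.closure_eq]
    refine union_subset subset_union_left ?_
    rw [hIp]
    exact closure_connectedComponentIn_compl_subset p
  have hαC : ∀ t ∈ Set.Icc a b, α t ∈ C := fun t ht => mem_image_of_mem α ht
  have ha : a ∈ Set.Icc a b := left_mem_Icc.2 hlt.le
  have hb : b ∈ Set.Icc a b := right_mem_Icc.2 hlt.le
  have hg0 : ∀ z ∈ C ∪ I, f z - z ≠ 0 := fun z hz => sub_ne_zero.2 (hfix z hz)
  have hgc : ContinuousOn (fun z => f z - z) (C ∪ I) := hf.sub continuousOn_id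
  have hgα : ContinuousOn (fun t => f (α t) - α t) (Set.Icc a b) :=
    hgc.comp hc fun t ht => Or.inl (hαC t ht)
  -- a logarithm of the vector field along the curve
  let Lg : ℝ → ℂ := fun t =>
    (Real.log ‖f (α t) - α t‖ : ℂ) + 2 * Real.pi * Complex.I * θ t
  have hLgc : ContinuousOn Lg (Set.Icc a b) := by
    refine ContinuousOn.add ?_ (continuousOn_const.mul
      (Complex.continuous_ofReal.comp_continuousOn hθc))
    exact Complex.continuous_ofReal.comp_continuousOn
      (hgα.norm.log fun t ht => norm_ne_zero_iff.2 (hg0 _ (Or.inl (hαC t ht))))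
  have hLg : ∀ t ∈ Set.Icc a b, Complex.exp (Lg t) = f (α t) - α t := by
    intro t ht
    have h1 : 0 < ‖f (α t) - α t‖ := norm_pos_iff.2 (hg0 _ (Or.inl (hαC t ht)))
    simp only [Lg]
    rw [Complex.exp_add, ← Complex.ofReal_exp, Real.exp_log h1]
    exact (hθ t ht).symm
  have hLgd : Lg b - Lg a = (θ b - θ a) * (2 * Real.pi * Complex.I) := by
    simp only [Lg, hend]; ring
  -- a logarithm of `α - p`
  obtain ⟨Lp, hLpc, hLp⟩ : ∃ L : ℝ → ℂ, Continuous L ∧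
      ∀ t ∈ Set.Icc a b, Complex.exp (L t) = α t - p := by
    obtain ⟨L, hL, hLe⟩ := exists_continuous_log
      (u := fun t : ℝ => α (Set.projIcc a b hlt.le t) - p)
      ((hc.domRestrict.comp continuous_projIcc).sub continuous_const)
      (fun t => sub_ne_zero.2 fun h => hpC (h ▸ hαC _ (Set.projIcc a b hlt.le t).2))
    refine ⟨L, hL, fun t ht => ?_⟩
    rw [hLe, Set.projIcc_of_mem hlt.le ht]
  obtain ⟨n, hn⟩ := Complex.exp_eq_exp_iff_exists_int.1
    (show Complex.exp (Lg b) = Complex.exp (Lg a) by rw [hLg b hb, hLg a ha, hend])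
  obtain ⟨m, hm⟩ := Complex.exp_eq_exp_iff_exists_int.1
    (show Complex.exp (Lp b) = Complex.exp (Lp a) by rw [hLp b hb, hLp a ha, hend])
  have hθn : θ b - θ a = n := by
    have h1 : ((θ b - θ a : ℝ) : ℂ) * (2 * Real.pi * Complex.I)
        = n * (2 * Real.pi * Complex.I) := by
      push_cast
      rw [← hLgd, hn]; ring
    exact_mod_cast mul_right_cancel₀ Complex.two_pi_I_ne_zero h1
  -- `(α - p) ^ n / (f ∘ α - α) ^ m` has a logarithm which descends to the curve
  obtain ⟨H, hHc, hH⟩ := hα.exists_continuous_comp_eq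
    (h := fun t => n * Lp t - m * Lg t)
    ((continuousOn_const.mul hLpc.continuousOn).sub (continuousOn_const.mul hLgc))
    (by simp only [hm, hn]; ring)
  let G : ℂ → ℂ := fun z =>
    if z ∈ C ∪ I then (f z - z) ^ m * Complex.exp (H z) else (z - p) ^ n
  have hGK : EqOn G (fun z => (f z - z) ^ m * Complex.exp (H z)) (C ∪ I) :=
    fun z hz => if_pos hz
  have hGI : EqOn G (fun z => (z - p) ^ n) Iᶜ := by
    intro z hz
    by_cases hzC : z ∈ C
    · obtain ⟨t, ht, rfl⟩ := hzC
      rw [hGK (Or.inl (hαC t ht))]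
      dsimp only
      rw [hH t ht, ← hLg t ht, ← hLp t ht, ← Complex.exp_int_mul, ← Complex.exp_int_mul,
        ← Complex.exp_add]
      congr 1; ring
    · exact if_neg fun h => h.elim hzC hz
  have hGc : Continuous G := by
    rw [← continuousOn_univ]
    have hun : (univ : Set ℂ) = (C ∪ I) ∪ Iᶜ := by
      ext z; by_cases hz : z ∈ I <;> simp [hz]
    rw [hun]
    refine ContinuousOn.union_of_isClosed ?_ ?_ hKcl hIo.isClosed_compl
    · exact ((hgc.zpow₀ m fun z hz => Or.inl (hg0 z hz)).mul
        (Complex.continuous_exp.comp hHc).continuousOn).congr hGK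
    · refine ((continuousOn_id.sub continuousOn_const).zpow₀ n fun z hz => Or.inl ?_).congr hGI
      exact sub_ne_zero.2 fun h : z = p => hz (h ▸ hpI)
  have hG0 : ∀ z, G z ≠ 0 := by
    intro z
    by_cases hz : z ∈ C ∪ I
    · rw [hGK hz]
      exact mul_ne_zero (zpow_ne_zero _ (hg0 z hz)) (Complex.exp_ne_zero _)
    · have hzI : z ∈ Iᶜ := fun h => hz (Or.inr h)
      rw [hGI hzI]
      exact zpow_ne_zero _ (sub_ne_zero.2 fun h => hzI (h ▸ hpI))
  obtain ⟨R, hR0, hR⟩ := hIb.subset_ball_lt 0 p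
  have hn0 : n = 0 := eq_zero_of_extension_zpow hGc hG0 (p := p) hR0 fun z hz =>
    hGI fun hzI => by
      have h1 := hR hzI
      rw [mem_ball_iff_norm, hz] at h1
      exact lt_irrefl _ h1
  rw [hθn, hn0, Int.cast_zero]
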